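/- Let Q : 𝔻 → [0,∞] be measurable with ∫_𝔻 Φ(Q(z)) dxdy < ∞ for a non-decreasing convex function Φ : [0,∞] → [0,∞] satisfying ∫_{δ₀}^∞ dτ/(τ Φ⁻¹(τ)) = ∞ for some δ₀ > Φ(0). Then ∫₀¹ dr/(r q(r)) = ∞, where q(r) is the average of Q over the circle |z| = r. -/

import Mathlib

open ENNReal MeasureTheory Set Real

/-- The generalized inverse of a non-decreasing `Φ : [0,∞] → [0,∞]`:
`Φ⁻¹(τ) = inf { t : Φ(t) ≥ τ }`, with `inf ∅ = ∞`. -/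
noncomputable def incInv (Φ : ℝ≥0∞ → ℝ≥0∞) (τ : ℝ≥0∞) : ℝ≥0∞ :=
  sInf {t : ℝ≥0∞ | τ ≤ Φ t}

/-- pointwise chord estimate -/
lemma aux_chord (Φ : ℝ≥0∞ → ℝ≥0∞) (hΦ : Monotone Φ)
    (hconv : ∀ a b t₁ t₂ : ℝ≥0∞, a + b = 1 → Φ (a * t₁ + b * t₂) ≤ a * Φ t₁ + b * Φ t₂)
    (τ t x : ℝ≥0∞) (hτ : τ ≠ ∞) (h0 : 2 * Φ 0 < τ) (ht : t ≠ ∞) (hτt : τ ≤ Φ t) :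
    x * τ ≤ t * τ + 2 * t * Φ x := by
  have hΦ0 : Φ 0 < τ := lt_of_le_of_lt (by rw [two_mul]; exact le_self_add) h0
  have ht0 : t ≠ 0 := by
    rintro rfl
    exact absurd hτt (not_le.mpr hΦ0)
  rcases le_or_gt x t with hx | hx
  · exact le_trans (mul_le_mul_left hx τ) le_self_add
  have hx0 : x ≠ 0 := (lt_of_le_of_lt zero_le hx).ne'
  by_cases hxt : x = ∞
  · subst hxt
    by_cases hinf : Φ ∞ = ∞
    · rw [hinf, ENNReal.mul_top (by simp [ht0])]
      simp
    · exfalso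
      have h1 := hconv 2⁻¹ 2⁻¹ 0 ∞ ENNReal.inv_two_add_inv_two
      rw [mul_zero, zero_add, ENNReal.mul_top (by simp), ← mul_add] at h1
      have h2 : 2 * Φ ∞ ≤ Φ 0 + Φ ∞ := by
        calc 2 * Φ ∞ ≤ 2 * (2⁻¹ * (Φ 0 + Φ ∞)) := by gcongr
          _ = _ := by rw [← mul_assoc, ENNReal.mul_inv_cancel (by simp) (by simp), one_mul]
      rw [two_mul] at h2
      have h3 := (ENNReal.add_le_add_iff_right hinf).1 h2
      exact absurd ((hτt.trans (hΦ le_top)).trans h3) (not_le.mpr hΦ0)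
  · have hb : t / x ≤ 1 := ENNReal.div_le_of_le_mul (by simpa using hx.le)
    have h1 := hconv (1 - t / x) (t / x) 0 x (tsub_add_cancel_of_le hb)
    rw [mul_zero, zero_add, ENNReal.div_mul_cancel hx0 hxt] at h1
    have h2 : τ ≤ Φ 0 + t / x * Φ x := by
      refine hτt.trans (h1.trans ?_)
      gcongr
      exact mul_le_of_le_one_left zero_le tsub_le_self
    have h3 : 2 * τ ≤ τ + 2 * (t / x * Φ x) := by
      calc 2 * τ ≤ 2 * (Φ 0 + t / x * Φ x) := by gcongr
        _ = 2 * Φ 0 + 2 * (t / x * Φ x) := by ring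
        _ ≤ _ := by gcongr
    have h4 : τ ≤ 2 * (t / x * Φ x) := by
      rw [two_mul τ] at h3
      exact (ENNReal.add_le_add_iff_left hτ).1 h3
    calc x * τ ≤ x * (2 * (t / x * Φ x)) := by gcongr
      _ = 2 * (t / x * x) * Φ x := by ring
      _ = 2 * t * Φ x := by rw [ENNReal.div_mul_cancel hx0 hxt]
      _ ≤ _ := le_add_self

lemma aux_avg (Φ : ℝ≥0∞ → ℝ≥0∞) (hΦ : Monotone Φ)
    (hconv : ∀ a b t₁ t₂ : ℝ≥0∞, a + b = 1 → Φ (a * t₁ + b * t₂) ≤ a * Φ t₁ + b * Φ t₂)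
    (u : ℝ → ℝ≥0∞) (hu : Measurable u)
    (τ : ℝ≥0∞) (hτ : τ ≠ ∞) (h0 : 2 * Φ 0 < τ)
    (hH : (∫⁻ θ in Ioo (0:ℝ) (2 * π), Φ (u θ)) / ENNReal.ofReal (2 * π) ≤ τ) :
    (∫⁻ θ in Ioo (0:ℝ) (2 * π), u θ) / ENNReal.ofReal (2 * π) ≤ 3 * incInv Φ τ := by
  have hτ0 : τ ≠ 0 := (lt_of_le_of_lt zero_le h0).ne'
  have hp0 : ENNReal.ofReal (2 * π) ≠ 0 := by simp [Real.pi_pos]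
  have hpt : ENNReal.ofReal (2 * π) ≠ ∞ := ENNReal.ofReal_ne_top
  rw [incInv, sInf_eq_iInf, ENNReal.mul_iInf_of_ne (by norm_num) (by norm_num)]
  refine le_iInf fun t => ?_
  rw [ENNReal.mul_iInf_of_ne (by norm_num) (by norm_num)]
  refine le_iInf fun ht => ?_
  by_cases htt : t = ∞
  · subst htt; simp
  rw [ENNReal.div_le_iff hp0 hpt] at hH ⊢
  have hm : Measurable fun θ => Φ (u θ) := hΦ.measurable.comp hu
  have key : (∫⁻ θ in Ioo (0:ℝ) (2 * π), u θ) * τ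
      ≤ t * τ * ENNReal.ofReal (2 * π) + 2 * t * (∫⁻ θ in Ioo (0:ℝ) (2 * π), Φ (u θ)) := by
    rw [← lintegral_mul_const _ hu, ← lintegral_const_mul _ hm]
    calc _ ≤ ∫⁻ θ in Ioo (0:ℝ) (2 * π), (t * τ + 2 * t * Φ (u θ)) :=
          lintegral_mono fun θ => aux_chord Φ hΦ hconv τ t (u θ) hτ h0 htt ht
      _ = _ := by
          rw [lintegral_add_left measurable_const]
          simp
  have : (∫⁻ θ in Ioo (0:ℝ) (2 * π), u θ) * τ ≤ (3 * t * ENNReal.ofReal (2 * π)) * τ := by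
    refine key.trans ?_
    calc _ ≤ t * τ * ENNReal.ofReal (2 * π) + 2 * t * (τ * ENNReal.ofReal (2 * π)) := by gcongr
      _ = _ := by ring
  exact (ENNReal.mul_le_mul_iff_left hτ0 hτ).1 this

lemma aux_dich (Φ : ℝ≥0∞ → ℝ≥0∞) (hΦ : Monotone Φ)
    (hconv : ∀ a b t₁ t₂ : ℝ≥0∞, a + b = 1 → Φ (a * t₁ + b * t₂) ≤ a * Φ t₁ + b * Φ t₂)
    (δ : ℝ≥0∞) (hδ : Φ 0 < δ) :
    (∀ τ, incInv Φ τ = 0) ∨ incInv Φ δ ≠ 0 := by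
  by_cases h : ∃ t, t ≠ 0 ∧ Φ t ≠ ∞
  · right
    obtain ⟨t, ht, htt⟩ := h
    have hd : δ - Φ 0 ≠ 0 := (tsub_pos_of_lt hδ).ne'
    obtain ⟨n, hn, hlt⟩ := ENNReal.exists_nnreal_pos_mul_lt htt hd
    set b : ℝ≥0∞ := min n 1 with hb
    have hb0 : b ≠ 0 := by simp [hb, hn.ne']
    have hb1 : b ≤ 1 := min_le_right _ _
    have h1 := hconv (1 - b) b 0 t (tsub_add_cancel_of_le hb1)
    have h2 : Φ (b * t) < δ := by
      rw [mul_zero, zero_add] at h1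
      calc Φ (b * t) ≤ Φ 0 + n * Φ t := by
            refine h1.trans ?_
            gcongr
            · exact mul_le_of_le_one_left zero_le tsub_le_self
            · exact min_le_left _ _
        _ < δ := by
            rw [add_comm]; exact lt_tsub_iff_right.1 hlt
    have h3 : b * t ≤ incInv Φ δ := by
      refine le_sInf fun s hs => ?_
      by_contra hc
      exact absurd (le_trans hs (hΦ (not_le.1 hc).le)) (not_le.2 h2)
    intro h4
    rw [h4] at h3
    exact (mul_ne_zero hb0 ht) (le_antisymm h3 zero_le)
  · left
    push Not at h
    intro τ
    refine le_antisymm (le_of_forall_gt_imp_ge_of_dense fun s hs => sInf_le ?_) zero_le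
    show τ ≤ Φ s
    rw [h s hs.ne']; exact le_top

lemma aux_mono (Φ : ℝ≥0∞ → ℝ≥0∞) : Monotone (incInv Φ) := by
  intro a b hab
  exact sInf_le_sInf fun t ht => le_trans hab ht

lemma aux_polar (F : ℂ → ℝ≥0∞) (hF : Measurable F) :
    ∫⁻ r in Ioo (0:ℝ) 1, ENNReal.ofReal r *
      ∫⁻ θ in Ioo (0:ℝ) (2 * π), F ((r : ℂ) * Complex.exp (θ * Complex.I))
      = ∫⁻ z in Metric.ball (0:ℂ) 1, F z := by
  set G : ℂ → ℝ≥0∞ := (Metric.ball (0:ℂ) 1).indicator F with hG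
  have hGm : Measurable G := hF.indicator Metric.isOpen_ball.measurableSet
  have h1 : ∫⁻ z in Metric.ball (0:ℂ) 1, F z = ∫⁻ z, G (-z) := by
    rw [← lintegral_indicator Metric.isOpen_ball.measurableSet]
    exact (lintegral_neg_eq_self (μ := (volume : Measure ℂ)) G).symm
  have hmm : Measurable fun p : ℝ × ℝ => ((p.1 : ℂ) * Complex.exp (p.2 * Complex.I)) := by
    fun_prop
  rw [h1, ← Complex.lintegral_comp_polarCoord_symm, polarCoord_target,
    Measure.volume_eq_prod, ← Measure.prod_restrict]
  have hs : ∀ p : ℝ × ℝ, -(Complex.polarCoord.symm p)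
      = (p.1 : ℂ) * Complex.exp (((p.2 + π : ℝ) : ℂ) * Complex.I) := by
    intro p
    rw [Complex.polarCoord_symm_apply]
    push_cast
    rw [add_mul, Complex.exp_add, Complex.exp_pi_mul_I, Complex.exp_mul_I]
    ring
  simp only [hs, smul_eq_mul]
  rw [lintegral_prod _ (by
    apply Measurable.aemeasurable
    apply Measurable.mul (by fun_prop)
    exact hGm.comp (by fun_prop))]
  have h2 : ∀ r : ℝ, 0 < r → ∫⁻ θ in Ioo (-π) π, ENNReal.ofReal r *
      G ((r : ℂ) * Complex.exp (((θ + π : ℝ) : ℂ) * Complex.I))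
      = (Ioo (0:ℝ) 1).indicator (fun r => ENNReal.ofReal r *
      ∫⁻ θ in Ioo (0:ℝ) (2 * π), F ((r : ℂ) * Complex.exp (θ * Complex.I))) r := by
    intro r hr
    have hmem : ∀ θ : ℝ, (r : ℂ) * Complex.exp (θ * Complex.I) ∈ Metric.ball (0:ℂ) 1 ↔ r < 1 := by
      intro θ
      simp [Complex.norm_exp_ofReal_mul_I, abs_of_pos hr]
    rw [lintegral_const_mul' _ _ ENNReal.ofReal_ne_top]
    have h3 : ∫⁻ θ in Ioo (-π) π, G ((r : ℂ) * Complex.exp (((θ + π : ℝ) : ℂ) * Complex.I))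
        = ∫⁻ θ in Ioo (0:ℝ) (2 * π), G ((r : ℂ) * Complex.exp (θ * Complex.I)) := by
      rw [← lintegral_indicator measurableSet_Ioo, ← lintegral_indicator measurableSet_Ioo,
        ← lintegral_add_right_eq_self ((Ioo 0 (2 * π)).indicator _) π]
      congr 1
      ext θ
      have : θ ∈ Ioo (-π) π ↔ θ + π ∈ Ioo 0 (2 * π) := by
        simp only [mem_Ioo]
        constructor <;> rintro ⟨h, h'⟩ <;> constructor <;> linarith
      by_cases hθ : θ ∈ Ioo (-π) π
      · rw [indicator_of_mem hθ, indicator_of_mem (this.1 hθ)]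
      · rw [indicator_of_notMem hθ, indicator_of_notMem (fun h => hθ (this.2 h))]
    rw [h3]
    by_cases h4 : r < 1
    · rw [indicator_of_mem (show r ∈ Ioo (0:ℝ) 1 from ⟨hr, h4⟩)]
      congr 1
      refine lintegral_congr fun θ => ?_
      rw [hG, indicator_of_mem ((hmem θ).2 h4)]
    · rw [indicator_of_notMem (show r ∉ Ioo (0:ℝ) 1 from fun h => h4 h.2)]
      have : ∀ θ : ℝ, G ((r : ℂ) * Complex.exp (θ * Complex.I)) = 0 := fun θ => by
        rw [hG, indicator_of_notMem (fun h => h4 ((hmem θ).1 h))]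
      simp [this]
  rw [setLIntegral_congr_fun measurableSet_Ioi (fun r hr => h2 r hr),
    lintegral_indicator measurableSet_Ioo, Measure.restrict_restrict measurableSet_Ioo,
    inter_eq_left.2 Ioo_subset_Ioi_self]

lemma aux_subst (K : ℝ) (hK : 0 < K) (g : ℝ → ℝ≥0∞) :
    ∫⁻ τ in Ioi (K ^ 2), g τ
      = ∫⁻ r in Ioo (0:ℝ) K⁻¹, ENNReal.ofReal (2 * (r ^ 3)⁻¹) * g ((r ^ 2)⁻¹) := by
  have himg : (fun r : ℝ => (r ^ 2)⁻¹) '' Ioo (0:ℝ) K⁻¹ = Ioi (K ^ 2) := by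
    ext y
    simp only [mem_image, mem_Ioo, mem_Ioi]
    constructor
    · rintro ⟨r, ⟨h1, h2⟩, rfl⟩
      rw [lt_inv_comm₀ (by positivity) (by positivity), ← inv_pow]
      gcongr
    · intro hy
      have hy0 : 0 < y := lt_trans (by positivity) hy
      refine ⟨(√y)⁻¹, ⟨by positivity, ?_⟩, ?_⟩
      · exact inv_strictAnti₀ hK (Real.lt_sqrt_of_sq_lt hy)
      · rw [inv_pow, Real.sq_sqrt hy0.le, inv_inv]
  rw [← himg, lintegral_image_eq_lintegral_abs_deriv_mul (f' := fun r => -(2 * (r ^ 3)⁻¹))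
    measurableSet_Ioo]
  · refine setLIntegral_congr_fun measurableSet_Ioo fun r hr => ?_
    have : 0 < r := hr.1
    rw [abs_neg, abs_of_pos (by positivity)]
  · intro r hr
    have : r ≠ 0 := hr.1.ne'
    have h := ((hasDerivAt_pow 2 r).inv (by positivity)).hasDerivWithinAt (s := Ioo (0:ℝ) K⁻¹)
    refine h.congr_deriv ?_
    norm_num
    field_simp
  · intro a ha b hb hab
    simp only [inv_inj] at hab
    exact (pow_left_inj₀ ha.1.le hb.1.le two_ne_zero).1 hab

/-- Let `Q : 𝔻 → [0,∞]` be measurable with `∫_𝔻 Φ(Q(z)) dxdy < ∞` for a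
non-decreasing convex function `Φ : [0,∞] → [0,∞]` satisfying
`∫_{δ₀}^∞ dτ/(τ Φ⁻¹(τ)) = ∞` for some `δ₀ > Φ(0)`.  Then
`∫₀¹ dr/(r q(r)) = ∞`, where `q(r)` is the average of `Q` over the circle
`|z| = r`. -/
theorem stmt11 (Q : ℂ → ℝ≥0∞) (hQ : Measurable Q)
    (Φ : ℝ≥0∞ → ℝ≥0∞) (hΦ : Monotone Φ)
    (hconv : ∀ a b t₁ t₂ : ℝ≥0∞, a + b = 1 → Φ (a * t₁ + b * t₂) ≤ a * Φ t₁ + b * Φ t₂)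
    (hfin : ∫⁻ z in Metric.ball (0:ℂ) 1, Φ (Q z) < ∞)
    (δ₀ : ℝ) (hδ₀ : Φ 0 < ENNReal.ofReal δ₀)
    (hdiv : ∫⁻ τ in Ioi δ₀, (ENNReal.ofReal τ * incInv Φ (ENNReal.ofReal τ))⁻¹ = ∞)
    (q : ℝ → ℝ≥0∞)
    (hq : ∀ r : ℝ, q r =
      (∫⁻ θ in Ioo (0:ℝ) (2 * π), Q ((r : ℂ) * Complex.exp (θ * Complex.I))) /
        ENNReal.ofReal (2 * π)) :
    ∫⁻ r in Ioo (0:ℝ) 1, (ENNReal.ofReal r * q r)⁻¹ = ∞ := by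
  have hδpos : 0 < δ₀ := by
    by_contra h
    rw [ENNReal.ofReal_of_nonpos (not_lt.1 h)] at hδ₀
    exact absurd hδ₀ (by simp)
  have hp0 : ENNReal.ofReal (2 * π) ≠ 0 := by simp [Real.pi_pos]
  set H : ℝ → ℝ≥0∞ := fun r =>
    (∫⁻ θ in Ioo (0:ℝ) (2 * π), Φ (Q ((r : ℂ) * Complex.exp (θ * Complex.I)))) /
        ENNReal.ofReal (2 * π) with hH
  have hΦQ : Measurable fun z => Φ (Q z) := hΦ.measurable.comp hQ
  have hHm : Measurable H := by
    refine Measurable.div_const ?_ _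
    refine Measurable.lintegral_prod_right' (f := fun p : ℝ × ℝ =>
      Φ (Q ((p.1 : ℂ) * Complex.exp (p.2 * Complex.I)))) ?_
    exact hΦQ.comp (by fun_prop)
  have hrHm : Measurable fun r : ℝ => ENNReal.ofReal r * H r :=
    ENNReal.measurable_ofReal.mul hHm
  have hIH : ∫⁻ r in Ioo (0:ℝ) 1, ENNReal.ofReal r * H r ≠ ∞ := by
    have h1 : ∫⁻ r in Ioo (0:ℝ) 1, ENNReal.ofReal r * H r
        = (∫⁻ z in Metric.ball (0:ℂ) 1, Φ (Q z)) * (ENNReal.ofReal (2 * π))⁻¹ := by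
      rw [← aux_polar _ hΦQ, ← lintegral_mul_const' _ _ (ENNReal.inv_ne_top.2 hp0)]
      refine lintegral_congr fun r => ?_
      simp only [hH, div_eq_mul_inv, mul_assoc]
    rw [h1]
    exact ENNReal.mul_ne_top hfin.ne (ENNReal.inv_ne_top.2 hp0)
  have hqb : ∀ r : ℝ, ∀ τ : ℝ≥0∞, τ ≠ ∞ → 2 * Φ 0 < τ → H r ≤ τ → q r ≤ 3 * incInv Φ τ := by
    intro r τ h1 h2 h3
    rw [hq r]
    exact aux_avg Φ hΦ hconv (fun θ => Q ((r : ℂ) * Complex.exp (θ * Complex.I)))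
      (hQ.comp (by fun_prop)) τ h1 h2 h3
  have hΦ0 : Φ 0 ≠ ∞ := (hδ₀.trans ENNReal.ofReal_lt_top).ne
  rcases aux_dich Φ hΦ hconv _ hδ₀ with hz | hz
  · have hae : ∀ᵐ r ∂(volume.restrict (Ioo (0:ℝ) 1)), (ENNReal.ofReal r * q r)⁻¹ = ∞ := by
      filter_upwards [ae_lt_top hrHm hIH, ae_restrict_mem measurableSet_Ioo] with r hr hr1
      have hr0 : ENNReal.ofReal r ≠ 0 := by simp [hr1.1]
      have hHr : H r ≠ ∞ := by
        intro h
        rw [h, ENNReal.mul_top hr0] at hr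
        exact lt_irrefl _ hr
      have h1 := hqb r (H r + 2 * Φ 0 + 1) (by finiteness) (by
        refine ENNReal.lt_add_right (by finiteness) one_ne_zero |>.trans_le' ?_
        exact le_add_self) (by rw [add_assoc]; exact le_self_add)
      rw [hz, mul_zero] at h1
      rw [le_antisymm h1 zero_le]; simp
    rw [lintegral_congr_ae hae]
    simp
  · set K : ℝ := 1 + 2 * δ₀ with hK
    have hK1 : 1 ≤ K := by linarith
    have hKpos : 0 < K := by linarith
    have hKsq : 2 * δ₀ < K ^ 2 := by nlinarith
    -- tail divergence
    have htail : ∫⁻ τ in Ioi (K ^ 2), (ENNReal.ofReal τ * incInv Φ (ENNReal.ofReal τ))⁻¹ = ∞ := by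
      have hsplit : Ioi δ₀ = Ioc δ₀ (K ^ 2) ∪ Ioi (K ^ 2) :=
        (Ioc_union_Ioi_eq_Ioi (by linarith)).symm
      by_contra hne
      have hle : ∫⁻ τ in Ioc δ₀ (K ^ 2), (ENNReal.ofReal τ * incInv Φ (ENNReal.ofReal τ))⁻¹
          ≤ ∫⁻ τ in Ioc δ₀ (K ^ 2), (ENNReal.ofReal δ₀ * incInv Φ (ENNReal.ofReal δ₀))⁻¹ := by
        refine setLIntegral_mono measurable_const fun τ hτ => ?_
        have := ENNReal.ofReal_le_ofReal hτ.1.le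
        exact ENNReal.inv_le_inv.2 (mul_le_mul' this (aux_mono Φ this))
      have hfin2 : ∫⁻ τ in Ioc δ₀ (K ^ 2),
          (ENNReal.ofReal δ₀ * incInv Φ (ENNReal.ofReal δ₀))⁻¹ ≠ ∞ := by
        rw [setLIntegral_const]
        refine ENNReal.mul_ne_top (ENNReal.inv_ne_top.2 (mul_ne_zero (by simp [hδpos]) hz)) ?_
        simp
      rw [hsplit] at hdiv
      have h5 := lintegral_union_le
        (fun τ => (ENNReal.ofReal τ * incInv Φ (ENNReal.ofReal τ))⁻¹) (Ioc δ₀ (K ^ 2))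
        (Ioi (K ^ 2)) (μ := volume)
      rw [hdiv] at h5
      exact (ENNReal.add_ne_top.2 ⟨ne_top_of_le_ne_top hfin2 hle, hne⟩) (top_le_iff.1 h5)
    rw [aux_subst K hKpos] at htail
    set C : ℝ≥0∞ := 2 * (incInv Φ (ENNReal.ofReal δ₀))⁻¹ with hC
    have hCt : C ≠ ∞ := ENNReal.mul_ne_top (by simp) (ENNReal.inv_ne_top.2 hz)
    have hpt : ∀ r ∈ Ioo (0:ℝ) K⁻¹, ENNReal.ofReal (2 * (r ^ 3)⁻¹) *
        (ENNReal.ofReal ((r ^ 2)⁻¹) * incInv Φ (ENNReal.ofReal ((r ^ 2)⁻¹)))⁻¹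
        ≤ 6 * (ENNReal.ofReal r * q r)⁻¹ + C * (ENNReal.ofReal r * H r) := by
      intro r hr
      have hr0 : 0 < r := hr.1
      have hτK : K ^ 2 < (r ^ 2)⁻¹ := by
        rw [lt_inv_comm₀ (by positivity) (by positivity), ← inv_pow]
        have := hr.2
        gcongr
      set Ψ := incInv Φ (ENNReal.ofReal ((r ^ 2)⁻¹)) with hΨ
      have hlhs : ENNReal.ofReal (2 * (r ^ 3)⁻¹) * (ENNReal.ofReal ((r ^ 2)⁻¹) * Ψ)⁻¹
          = 2 * (ENNReal.ofReal r⁻¹ * Ψ⁻¹) := by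
        rw [ENNReal.mul_inv (by left; simp [hr0]) (by left; simp),
          ← ENNReal.ofReal_inv_of_pos (by positivity), inv_inv, ← mul_assoc,
          ← ENNReal.ofReal_mul (by positivity), ← mul_assoc]
        congr 1
        have : (2 : ℝ≥0∞) = ENNReal.ofReal 2 := by simp
        rw [this, ← ENNReal.ofReal_mul (by positivity)]
        congr 1
        field_simp
      rw [hlhs]
      rcases le_or_gt (H r) (ENNReal.ofReal ((r ^ 2)⁻¹)) with hle | hgt
      · refine le_trans ?_ le_self_add
        have h2 : 2 * Φ 0 < ENNReal.ofReal ((r ^ 2)⁻¹) := by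
          calc 2 * Φ 0 ≤ 2 * ENNReal.ofReal δ₀ := by gcongr
            _ = ENNReal.ofReal (2 * δ₀) := by rw [ENNReal.ofReal_mul (by norm_num)]; simp
            _ < _ := by
              rw [ENNReal.ofReal_lt_ofReal_iff (by positivity)]
              linarith
        have h3 := hqb r _ ENNReal.ofReal_ne_top h2 hle
        rw [← hΨ] at h3
        have h4 : Ψ⁻¹ ≤ 3 * (q r)⁻¹ := by
          have h5 : (3 * Ψ)⁻¹ ≤ (q r)⁻¹ := ENNReal.inv_le_inv.2 h3
          rw [ENNReal.mul_inv (by simp) (by simp)] at h5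
          calc Ψ⁻¹ = 3 * (3⁻¹ * Ψ⁻¹) := by
                rw [← mul_assoc, ENNReal.mul_inv_cancel (by simp) (by simp), one_mul]
            _ ≤ _ := by gcongr
        rw [ENNReal.mul_inv (by left; simp [hr0]) (by left; simp),
          ← ENNReal.ofReal_inv_of_pos hr0]
        calc 2 * (ENNReal.ofReal r⁻¹ * Ψ⁻¹) ≤ 2 * (ENNReal.ofReal r⁻¹ * (3 * (q r)⁻¹)) := by
              gcongr
          _ = _ := by ring
      · refine le_trans ?_ le_add_self
        have h2 : ENNReal.ofReal r⁻¹ ≤ ENNReal.ofReal r * H r := by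
          calc ENNReal.ofReal r⁻¹ = ENNReal.ofReal r * ENNReal.ofReal ((r ^ 2)⁻¹) := by
                rw [← ENNReal.ofReal_mul hr0.le]
                congr 1
                field_simp
            _ ≤ _ := by gcongr
        have h3 : Ψ⁻¹ ≤ (incInv Φ (ENNReal.ofReal δ₀))⁻¹ := by
          refine ENNReal.inv_le_inv.2 (aux_mono Φ (ENNReal.ofReal_le_ofReal ?_))
          linarith
        calc 2 * (ENNReal.ofReal r⁻¹ * Ψ⁻¹)
            ≤ 2 * (ENNReal.ofReal r * H r * (incInv Φ (ENNReal.ofReal δ₀))⁻¹) := by gcongr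
          _ = _ := by rw [hC]; ring
    by_contra hne
    have hsub : Ioo (0:ℝ) K⁻¹ ⊆ Ioo 0 1 := Ioo_subset_Ioo_right (inv_le_one_of_one_le₀ hK1)
    have h6 : ∫⁻ r in Ioo (0:ℝ) K⁻¹, (6 * (ENNReal.ofReal r * q r)⁻¹
        + C * (ENNReal.ofReal r * H r)) ≠ ∞ := by
      rw [lintegral_add_right _ (hrHm.const_mul C), lintegral_const_mul' _ _ (by simp),
        lintegral_const_mul' _ _ hCt]
      refine ENNReal.add_ne_top.2 ⟨ENNReal.mul_ne_top (by simp) ?_, ENNReal.mul_ne_top hCt ?_⟩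
      · exact ne_top_of_le_ne_top hne (lintegral_mono_set hsub)
      · exact ne_top_of_le_ne_top hIH (lintegral_mono_set hsub)
    refine h6 (top_le_iff.1 ?_)
    rw [← htail]
    exact setLIntegral_mono' measurableSet_Ioo hpt
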